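/- Let T : List Bool → Bool be primitive recursive with T [] = true, downward closed under prefixes, and pruned: for every σ with T σ = true there is a b : Bool with T (σ ++ [b]) = true. Then there exists a primitive recursive P : ℕ → Bool which is a path through T: T (P↾n) = true for all n. -/

import Mathlib

/-- `P↾n`, the list `[P 0, P 1, …, P (n-1)]`. -/
def restrictFun (P : ℕ → Bool) (n : ℕ) : List Bool :=
  List.ofFn fun i : Fin n => P i

/-- The greedy path through `T`, up to level `n`: it extends by `true` whenever `T` allows it. -/
def greedyBranch (T : List Bool → Bool) (n : ℕ) : List Bool :=
  n.rec [] fun _ σ => σ ++ [T (σ ++ [true])]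

theorem greedyBranch_succ (T : List Bool → Bool) (n : ℕ) :
    greedyBranch T (n + 1) = greedyBranch T n ++ [T (greedyBranch T n ++ [true])] :=
  rfl

theorem primrec_greedyBranch {T : List Bool → Bool} (hT : Primrec T) :
    Primrec (greedyBranch T) := by
  have hstep : Primrec fun σ : List Bool => σ ++ [T (σ ++ [true])] :=
    Primrec.list_concat.comp .id (hT.comp (Primrec.list_concat.comp .id (.const true)))
  exact Primrec.nat_rec₁ [] (hstep.comp Primrec.snd).to₂

theorem greedyBranch_mem {T : List Bool → Bool} (hroot : T [] = true)
    (hpruned : ∀ σ : List Bool, T σ = true → ∃ b : Bool, T (σ ++ [b]) = true) (n : ℕ) :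
    T (greedyBranch T n) = true := by
  induction n with
  | zero => exact hroot
  | succ n ih =>
    rw [greedyBranch_succ]
    obtain ⟨b, hb⟩ := hpruned _ ih
    cases h : T (greedyBranch T n ++ [true]) <;> cases b <;> simp_all

theorem restrictFun_succ (P : ℕ → Bool) (n : ℕ) :
    restrictFun P (n + 1) = restrictFun P n ++ [P n] := by
  simp only [restrictFun, List.ofFn_succ_last, Fin.val_castSucc, Fin.val_last]

theorem restrictFun_greedy (T : List Bool → Bool) (n : ℕ) :
    restrictFun (fun k => T (greedyBranch T k ++ [true])) n = greedyBranch T n := by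
  induction n with
  | zero => simp [restrictFun, greedyBranch]
  | succ n ih => rw [restrictFun_succ, ih, greedyBranch_succ]

theorem stmt12 (T : List Bool → Bool) (hT : Primrec T) (hroot : T [] = true)
    (hdc : ∀ σ τ : List Bool, σ <+: τ → T τ = true → T σ = true)
    (hpruned : ∀ σ : List Bool, T σ = true → ∃ b : Bool, T (σ ++ [b]) = true) :
    ∃ P : ℕ → Bool, Primrec P ∧ ∀ n, T (restrictFun P n) = true := by
  refine ⟨fun n => T (greedyBranch T n ++ [true]), ?_, fun n => ?_⟩
  · exact hT.comp (Primrec.list_concat.comp (primrec_greedyBranch hT) (.const true))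
  · rw [restrictFun_greedy]
    exact greedyBranch_mem hroot hpruned n
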